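/- For every (t,α) ∈ ℝ × ℝ^{L−1}, the Christoffel symbol Γ^0_{00}(t,α) equals (N(t) C(t) + A(t,α) A'(t,α)) / (N(t) B(t) + A(t,α)²), where C(t) = Σ_{m=1}^{L−1} p_m'(t) p_m''(t) and A'(t,α) = w''(t) − Σ_{m=1}^{L−1} p_m''(t) α_m. -/

import Mathlib

/-!
Formalization of results from "A geometric approach to equilibrium selection":
the metric, Christoffel symbols and curvature of the equilibrium manifold of a
two-consumer exchange economy with `L` goods, parametrized by
`Φ(t,α) = (p_1(t),…,p_{L−1}(t), α_1,…,α_{L−1}, w(t) − Σ_m p_m(t) α_m)`.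

Indices run over `Fin L`, where the index `0` corresponds to the coordinate
`x_0 = t` and an index `i ≠ 0` corresponds to the coordinate `x_i = α_i`
(the component `α 0` of `α : Fin L → ℝ` is never used, so `α` is just a copy
of `ℝ^{L−1}` together with an irrelevant extra coordinate).
-/

open Matrix BigOperators

noncomputable section

namespace EqSelection

variable {L : ℕ}

/-- `A(t,α) = w'(t) − Σ_{m=1}^{L−1} p_m'(t) α_m`. -/
def eqA [NeZero L] (p : Fin L → ℝ → ℝ) (w : ℝ → ℝ) (t : ℝ) (α : Fin L → ℝ) : ℝ :=
  deriv w t - ∑ m ∈ Finset.univ \ {0}, deriv (p m) t * α m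

/-- `A'(t,α) = w''(t) − Σ_{m=1}^{L−1} p_m''(t) α_m`. -/
def eqA' [NeZero L] (p : Fin L → ℝ → ℝ) (w : ℝ → ℝ) (t : ℝ) (α : Fin L → ℝ) : ℝ :=
  deriv (deriv w) t - ∑ m ∈ Finset.univ \ {0}, deriv (deriv (p m)) t * α m

/-- `B(t) = Σ_{m=1}^{L−1} (p_m'(t))²`. -/
def eqB [NeZero L] (p : Fin L → ℝ → ℝ) (t : ℝ) : ℝ :=
  ∑ m ∈ Finset.univ \ {0}, (deriv (p m) t) ^ 2

/-- `N(t) = 1 + Σ_{m=1}^{L−1} (p_m(t))²`. -/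
def eqN [NeZero L] (p : Fin L → ℝ → ℝ) (t : ℝ) : ℝ :=
  1 + ∑ m ∈ Finset.univ \ {0}, (p m t) ^ 2

/-- `C(t) = Σ_{m=1}^{L−1} p_m'(t) p_m''(t)`. -/
def eqC [NeZero L] (p : Fin L → ℝ → ℝ) (t : ℝ) : ℝ :=
  ∑ m ∈ Finset.univ \ {0}, deriv (p m) t * deriv (deriv (p m)) t

/-- `P(t) = Σ_{m=1}^{L−1} p_m(t) p_m'(t)`. -/
def eqP [NeZero L] (p : Fin L → ℝ → ℝ) (t : ℝ) : ℝ :=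
  ∑ m ∈ Finset.univ \ {0}, p m t * deriv (p m) t

/-- The induced metric matrix `g(t,α)`: `g_{00} = B + A²`, `g_{0i} = g_{i0} = −p_i A`,
`g_{ij} = p_i p_j + δ_{ij}` for `i, j ≠ 0`. -/
def gMat [NeZero L] (p : Fin L → ℝ → ℝ) (w : ℝ → ℝ) (t : ℝ) (α : Fin L → ℝ) :
    Matrix (Fin L) (Fin L) ℝ :=
  Matrix.of fun i j =>
    if i = 0 then
      if j = 0 then eqB p t + (eqA p w t α) ^ 2 else -(p j t) * eqA p w t α
    else
      if j = 0 then -(p i t) * eqA p w t α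
      else p i t * p j t + (if i = j then 1 else 0)

/-- Partial derivative with respect to the coordinate `x_k`, where `x_0 = t`
and `x_i = α_i` for `i ≠ 0`. -/
def pder [NeZero L] (k : Fin L) (f : ℝ → (Fin L → ℝ) → ℝ) (t : ℝ) (α : Fin L → ℝ) : ℝ :=
  if k = 0 then deriv (fun s => f s α) t
  else deriv (fun s => f t (Function.update α k s)) (α k)

/-- Christoffel symbol
`Γ^k_{ij} = (1/2) Σ_{h=0}^{L−1} g^{hk} (∂g_{jh}/∂x_i + ∂g_{hi}/∂x_j − ∂g_{ij}/∂x_h)`,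
written `christoffel p w i j k`.  (Here `g^{hk}` denotes the entries of the inverse
matrix of `g`, i.e. of `(gMat p w t α)⁻¹`.) -/
def christoffel [NeZero L] (p : Fin L → ℝ → ℝ) (w : ℝ → ℝ) (i j k : Fin L)
    (t : ℝ) (α : Fin L → ℝ) : ℝ :=
  (1 / 2) * ∑ h : Fin L,
    (gMat p w t α)⁻¹ h k *
      (pder i (fun t' α' => gMat p w t' α' j h) t α
        + pder j (fun t' α' => gMat p w t' α' h i) t α
        - pder h (fun t' α' => gMat p w t' α' i j) t α)

/-- Curvature coefficient
`R^s_{ijk} = Σ_{m} Γ^m_{ik} Γ^s_{jm} − Σ_{m} Γ^m_{jk} Γ^s_{im} + ∂Γ^s_{ik}/∂x_j − ∂Γ^s_{jk}/∂x_i`,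
written `curvR p w i j k s`. -/
def curvR [NeZero L] (p : Fin L → ℝ → ℝ) (w : ℝ → ℝ) (i j k s : Fin L)
    (t : ℝ) (α : Fin L → ℝ) : ℝ :=
  (∑ m : Fin L, christoffel p w i k m t α * christoffel p w j m s t α)
    - (∑ m : Fin L, christoffel p w j k m t α * christoffel p w i m s t α)
    + pder j (christoffel p w i k s) t α - pder i (christoffel p w j k s) t α

/-- The coordinate tangent vectors `Φ_i(t,α) ∈ ℝ^{2L−1}` of the parametrization
`Φ(t,α) = (p_1(t),…,p_{L−1}(t), α_1,…,α_{L−1}, w(t) − Σ_m p_m(t) α_m)`: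
`Φ_0 = (p_1',…,p_{L−1}', 0,…,0, A)`, and for `i ≠ 0` the vector `Φ_i` has entry `1`
in position `(L−1)+i` (1-indexed), entry `−p_i` in the last position and `0` elsewhere. -/
def PhiVec [NeZero L] (p : Fin L → ℝ → ℝ) (w : ℝ → ℝ) (i : Fin L)
    (t : ℝ) (α : Fin L → ℝ) : Fin (2 * L - 1) → ℝ :=
  fun j =>
    if i = 0 then
      if h : (j : ℕ) < L - 1 then deriv (p ⟨(j : ℕ) + 1, by omega⟩) t
      else if (j : ℕ) = 2 * L - 2 then eqA p w t α else 0
    else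
      if (j : ℕ) + 1 = (L - 1) + (i : ℕ) then 1
      else if (j : ℕ) = 2 * L - 2 then -(p i t) else 0

/-- The matrix `M(t,α)` of Statement 2: `M_{00} = N`, `M_{0i} = M_{i0} = p_i A`,
`M_{ii} = (N − p_i²) B + A²`, `M_{ij} = −p_i p_j B` for `i ≠ j`, `i, j ≠ 0`. -/
def invNumer [NeZero L] (p : Fin L → ℝ → ℝ) (w : ℝ → ℝ) (t : ℝ) (α : Fin L → ℝ) :
    Matrix (Fin L) (Fin L) ℝ :=
  Matrix.of fun i j =>
    if i = 0 then
      if j = 0 then eqN p t else p j t * eqA p w t α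
    else
      if j = 0 then p i t * eqA p w t α
      else if i = j then (eqN p t - (p i t) ^ 2) * eqB p t + (eqA p w t α) ^ 2
      else -(p i t * p j t * eqB p t)

lemma sum_univ_eq_zero_add [NeZero L] (f : Fin L → ℝ) :
    ∑ i, f i = f 0 + ∑ i ∈ Finset.univ \ {0}, f i := by
  rw [add_comm, ← Finset.sum_singleton f 0]
  exact (Finset.sum_sdiff (Finset.subset_univ _)).symm

lemma ne_zero_of_mem_sdiff [NeZero L] {i : Fin L}
    (hi : i ∈ (Finset.univ : Finset (Fin L)) \ {0}) : i ≠ 0 := by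
  simpa using hi

section Metric

variable [NeZero L] (p : Fin L → ℝ → ℝ) (w : ℝ → ℝ) (t : ℝ) (α : Fin L → ℝ)

lemma gMat_mulVec_zero (x : Fin L → ℝ) :
    (gMat p w t α *ᵥ x) 0 = (eqB p t + eqA p w t α ^ 2) * x 0
      - eqA p w t α * ∑ m ∈ Finset.univ \ {0}, p m t * x m := by
  rw [Matrix.mulVec, dotProduct, sum_univ_eq_zero_add, Finset.mul_sum, sub_eq_add_neg,
    ← Finset.sum_neg_distrib]
  congr 1
  refine Finset.sum_congr rfl fun m hm => ?_
  simp only [gMat, of_apply, if_pos, if_neg (ne_zero_of_mem_sdiff hm)]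
  ring

lemma gMat_mulVec_of_ne_zero (x : Fin L → ℝ) {i : Fin L} (hi : i ≠ 0) :
    (gMat p w t α *ᵥ x) i = x i
      - p i t * (eqA p w t α * x 0 - ∑ m ∈ Finset.univ \ {0}, p m t * x m) := by
  have hsum : ∑ m ∈ Finset.univ \ {0}, gMat p w t α i m * x m
      = p i t * ∑ m ∈ Finset.univ \ {0}, p m t * x m + x i := by
    have hx : x i = ∑ m ∈ Finset.univ \ {0}, if i = m then x m else 0 := by
      rw [Finset.sum_ite_eq, if_pos (by simpa using hi)]
    rw [hx, Finset.mul_sum, ← Finset.sum_add_distrib]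
    refine Finset.sum_congr rfl fun m hm => ?_
    simp only [gMat, of_apply, if_neg hi, if_neg (ne_zero_of_mem_sdiff hm)]
    split_ifs <;> ring
  rw [Matrix.mulVec, dotProduct, sum_univ_eq_zero_add, hsum]
  simp only [gMat, of_apply, if_neg hi, if_pos]
  ring

lemma eqN_pos : 0 < eqN p t := by
  unfold eqN
  positivity

lemma eqB_nonneg : 0 ≤ eqB p t := by
  unfold eqB
  positivity

variable {p w t} in
lemma eqN_mul_eqB_add_sq_pos (hreg : 0 < eqB p t ∨ deriv w t ≠ 0) :
    0 < eqN p t * eqB p t + eqA p w t α ^ 2 := by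
  have hN := eqN_pos p t
  rcases (eqB_nonneg p t).lt_or_eq with hB | hB
  · positivity
  · have hw : deriv w t ≠ 0 := hreg.resolve_left hB.not_lt
    have hp : ∀ m ∈ Finset.univ \ {0}, deriv (p m) t ^ 2 = 0 :=
      (Finset.sum_eq_zero_iff_of_nonneg fun m _ => sq_nonneg _).1 hB.symm
    have hA : eqA p w t α = deriv w t := by
      rw [eqA, Finset.sum_eq_zero, sub_zero]
      intro m hm
      rw [pow_eq_zero_iff two_ne_zero |>.1 (hp m hm), zero_mul]
    rw [← hB, hA]
    positivity

variable {p w t α}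

lemma isUnit_det_gMat (hD : eqN p t * eqB p t + eqA p w t α ^ 2 ≠ 0) :
    IsUnit (gMat p w t α).det := by
  rw [isUnit_iff_ne_zero]
  intro hdet
  obtain ⟨x, hx, hgx⟩ := Matrix.exists_mulVec_eq_zero_iff.2 hdet
  set s := eqA p w t α * x 0 - ∑ m ∈ Finset.univ \ {0}, p m t * x m with hs
  have hxi : ∀ i, i ≠ 0 → x i = p i t * s := fun i hi => by
    have h := congrFun hgx i
    rw [gMat_mulVec_of_ne_zero _ _ _ _ _ hi, ← hs] at h
    exact sub_eq_zero.1 h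
  have hsum : ∑ m ∈ Finset.univ \ {0}, p m t * x m = (eqN p t - 1) * s := by
    rw [eqN, add_sub_cancel_left, Finset.sum_mul]
    refine Finset.sum_congr rfl fun m hm => ?_
    rw [hxi m (ne_zero_of_mem_sdiff hm)]
    ring
  have hzero := congrFun hgx 0
  rw [gMat_mulVec_zero, hsum, Pi.zero_apply] at hzero
  rw [hsum] at hs
  have hx0 : x 0 = 0 := by
    refine (mul_eq_zero.1 (?_ : (eqN p t * eqB p t + eqA p w t α ^ 2) * x 0 = 0)).resolve_left hD
    linear_combination eqN p t * hzero + eqA p w t α * (eqN p t - 1) * hs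
  have hs0 : s = 0 := by
    refine (mul_eq_zero.1 (?_ : eqN p t * s = 0)).resolve_left (eqN_pos p t).ne'
    linear_combination hs + eqA p w t α * hx0
  refine hx (funext fun i => ?_)
  by_cases hi : i = 0
  · rw [hi, hx0, Pi.zero_apply]
  · rw [hxi i hi, hs0, mul_zero, Pi.zero_apply]

/-- The `0`-th column of the inverse metric. -/
lemma gMat_inv_apply_zero (hD : eqN p t * eqB p t + eqA p w t α ^ 2 ≠ 0) (i : Fin L) :
    (gMat p w t α)⁻¹ i 0
      = (if i = 0 then eqN p t else p i t * eqA p w t α)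
        / (eqN p t * eqB p t + eqA p w t α ^ 2) := by
  set D := eqN p t * eqB p t + eqA p w t α ^ 2 with hDdef
  set v : Fin L → ℝ := fun i => if i = 0 then eqN p t else p i t * eqA p w t α with hv
  have hsum : ∑ m ∈ Finset.univ \ {0}, p m t * v m = (eqN p t - 1) * eqA p w t α := by
    rw [eqN, add_sub_cancel_left, Finset.sum_mul]
    refine Finset.sum_congr rfl fun m hm => ?_
    simp only [hv, if_neg (ne_zero_of_mem_sdiff hm)]
    ring
  have hgv : gMat p w t α *ᵥ v = D • Pi.single 0 1 := by
    funext i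
    by_cases hi : i = 0
    · subst hi
      rw [gMat_mulVec_zero, hsum]
      simp only [hv, hDdef, if_pos, Pi.smul_apply, Pi.single_eq_same, smul_eq_mul]
      ring
    · rw [gMat_mulVec_of_ne_zero _ _ _ _ _ hi, hsum]
      simp only [hv, if_neg hi, if_pos, Pi.smul_apply, Pi.single_eq_of_ne hi, smul_eq_mul]
      ring
  have hinv := congrArg (fun u => ((gMat p w t α)⁻¹ *ᵥ u) i) hgv
  simp only [Matrix.mulVec_mulVec, Matrix.nonsing_inv_mul _ (isUnit_det_gMat hD),
    Matrix.one_mulVec, Matrix.mulVec_smul, Matrix.mulVec_single_one, Pi.smul_apply,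
    Matrix.col_apply, smul_eq_mul] at hinv
  rw [eq_div_iff hD, mul_comm]
  exact hinv.symm

end Metric

section Derivatives

variable [NeZero L] {p : Fin L → ℝ → ℝ} {w : ℝ → ℝ}

lemma hasDerivAt_deriv_of_contDiff {f : ℝ → ℝ} (hf : ContDiff ℝ (⊤ : ℕ∞) f) (t : ℝ) :
    HasDerivAt (deriv f) (deriv (deriv f) t) t :=
  ((contDiff_infty_iff_deriv.1 hf).2.differentiable (by simp) t).hasDerivAt

lemma hasDerivAt_eqA (hp : ∀ i, ContDiff ℝ (⊤ : ℕ∞) (p i)) (hw : ContDiff ℝ (⊤ : ℕ∞) w)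
    (t : ℝ) (α : Fin L → ℝ) :
    HasDerivAt (fun s => eqA p w s α) (eqA' p w t α) t :=
  (hasDerivAt_deriv_of_contDiff hw t).fun_sub
    (HasDerivAt.fun_sum fun m _ => (hasDerivAt_deriv_of_contDiff (hp m) t).mul_const (α m))

lemma hasDerivAt_eqB (hp : ∀ i, ContDiff ℝ (⊤ : ℕ∞) (p i)) (t : ℝ) :
    HasDerivAt (fun s => eqB p s) (2 * eqC p t) t := by
  have h : HasDerivAt (fun s => eqB p s) (∑ m ∈ Finset.univ \ {0},
      2 * deriv (p m) t ^ 1 * deriv (deriv (p m)) t) t :=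
    HasDerivAt.fun_sum fun m _ => (hasDerivAt_deriv_of_contDiff (hp m) t).fun_pow 2
  refine h.congr_deriv ?_
  rw [eqC, Finset.mul_sum]
  exact Finset.sum_congr rfl fun m _ => by ring

lemma hasDerivAt_eqA_update (p : Fin L → ℝ → ℝ) (w : ℝ → ℝ) (t : ℝ) (α : Fin L → ℝ)
    {i : Fin L} (hi : i ≠ 0) (x : ℝ) :
    HasDerivAt (fun s => eqA p w t (Function.update α i s)) (-deriv (p i) t) x := by
  have h : HasDerivAt (fun s => eqA p w t (Function.update α i s))
      (-∑ m ∈ Finset.univ \ {0}, deriv (p m) t * (Pi.single i (1 : ℝ) : Fin L → ℝ) m) x :=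
    (HasDerivAt.fun_sum fun m _ =>
      ((hasDerivAt_pi.1 (hasDerivAt_update α i x)) m).const_mul (deriv (p m) t)).const_sub _
  refine h.congr_deriv ?_
  rw [Finset.sum_eq_single_of_mem i (by simpa using hi) fun m _ hm => by simp [hm]]
  simp

lemma pder_zero_gMat_zero_zero (hp : ∀ i, ContDiff ℝ (⊤ : ℕ∞) (p i))
    (hw : ContDiff ℝ (⊤ : ℕ∞) w) (t : ℝ) (α : Fin L → ℝ) :
    pder 0 (fun t' α' => gMat p w t' α' 0 0) t α
      = 2 * (eqC p t + eqA p w t α * eqA' p w t α) := by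
  simp only [pder, gMat, of_apply, if_pos]
  rw [((hasDerivAt_eqB hp t).fun_add ((hasDerivAt_eqA hp hw t α).fun_pow 2)).deriv]
  push_cast
  ring

lemma gMat_apply_zero_comm (p : Fin L → ℝ → ℝ) (w : ℝ → ℝ) (t : ℝ) (α : Fin L → ℝ) (i : Fin L) :
    gMat p w t α i 0 = gMat p w t α 0 i := by
  by_cases hi : i = 0 <;> simp [gMat, hi]

lemma pder_zero_gMat_zero_of_ne_zero (hp : ∀ i, ContDiff ℝ (⊤ : ℕ∞) (p i))
    (hw : ContDiff ℝ (⊤ : ℕ∞) w) (t : ℝ) (α : Fin L → ℝ) {i : Fin L} (hi : i ≠ 0) :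
    pder 0 (fun t' α' => gMat p w t' α' 0 i) t α
      = -(deriv (p i) t * eqA p w t α + p i t * eqA' p w t α) := by
  have hpi : HasDerivAt (p i) (deriv (p i) t) t :=
    ((hp i).differentiable (by simp) t).hasDerivAt
  simp only [pder, gMat, of_apply, if_pos, if_neg hi]
  rw [(hpi.fun_neg.fun_mul (hasDerivAt_eqA hp hw t α)).deriv]
  ring

lemma pder_gMat_zero_zero_of_ne_zero (p : Fin L → ℝ → ℝ) (w : ℝ → ℝ) (t : ℝ) (α : Fin L → ℝ)
    {i : Fin L} (hi : i ≠ 0) :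
    pder i (fun t' α' => gMat p w t' α' 0 0) t α
      = -(2 * eqA p w t α * deriv (p i) t) := by
  simp only [pder, gMat, of_apply, if_pos, if_neg hi]
  rw [(((hasDerivAt_eqA_update p w t α hi (α i)).fun_pow 2).const_add (eqB p t)).deriv,
    Function.update_eq_self]
  push_cast
  ring

end Derivatives

theorem statement_8 (L : ℕ) [NeZero L] (hL : 2 ≤ L)
    (p : Fin L → ℝ → ℝ) (w : ℝ → ℝ)
    (hp : ∀ i, ContDiff ℝ (⊤ : ℕ∞) (p i)) (hw : ContDiff ℝ (⊤ : ℕ∞) w)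
    (hreg : ∀ t : ℝ, 0 < eqB p t ∨ deriv w t ≠ 0) :
    ∀ (t : ℝ) (α : Fin L → ℝ),
      christoffel p w 0 0 0 t α
        = (eqN p t * eqC p t + eqA p w t α * eqA' p w t α) / (eqN p t * eqB p t + (eqA p w t α) ^ 2) := by
  intro t α
  have hD := (eqN_mul_eqB_add_sq_pos α (hreg t)).ne'
  simp only [christoffel, gMat_apply_zero_comm, gMat_inv_apply_zero hD]
  have hsum : ∑ i ∈ Finset.univ \ {0},
      (if i = 0 then eqN p t else p i t * eqA p w t α)
        / (eqN p t * eqB p t + eqA p w t α ^ 2) *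
      (pder 0 (fun t' α' => gMat p w t' α' 0 i) t α
        + pder 0 (fun t' α' => gMat p w t' α' 0 i) t α
        - pder i (fun t' α' => gMat p w t' α' 0 0) t α)
      = (eqN p t - 1) * (-(2 * eqA p w t α * eqA' p w t α)
        / (eqN p t * eqB p t + eqA p w t α ^ 2)) := by
    rw [eqN, add_sub_cancel_left, Finset.sum_mul]
    refine Finset.sum_congr rfl fun i hi => ?_
    have hi0 := ne_zero_of_mem_sdiff hi
    rw [if_neg hi0, pder_zero_gMat_zero_of_ne_zero hp hw t α hi0,
      pder_gMat_zero_zero_of_ne_zero p w t α hi0]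
    ring
  rw [sum_univ_eq_zero_add, hsum, if_pos rfl, pder_zero_gMat_zero_zero hp hw]
  field_simp
  ring

end EqSelection
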